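/- The double ray ℤ arrows the pair (2S_1, ℕ): every red-blue coloring of the edges of the double ray produces either two disjoint red edges or a blue one-way infinite path. -/

import Mathlib

open SimpleGraph

universe u v w x

/-- A monochromatic copy: `col = true` means red, `col = false` means blue.
There is a copy of `G` in `F` all of whose edges get color `col` under `c`. -/
def HasMonoCopy {α β : Type*} (F : SimpleGraph α) (c : Sym2 α → Bool) (col : Bool)
    (G : SimpleGraph β) : Prop :=
  ∃ f : β → α, Function.Injective f ∧
    ∀ ⦃x y⦄, G.Adj x y → F.Adj (f x) (f y) ∧ c s(f x, f y) = col

/-- `F → (G,H)`: every red-blue edge coloring of `F` yields a red `G` or a blue `H`. -/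
def Arrows {α β γ : Type*} (F : SimpleGraph α) (G : SimpleGraph β) (H : SimpleGraph γ) : Prop :=
  ∀ c : Sym2 α → Bool, HasMonoCopy F c true G ∨ HasMonoCopy F c false H

/-- A `(G,H)`-good coloring of `F`: neither a red copy of `G` nor a blue copy of `H`. -/
def GoodColoring {α β γ : Type*} (F : SimpleGraph α) (G : SimpleGraph β) (H : SimpleGraph γ)
    (c : Sym2 α → Bool) : Prop :=
  ¬ HasMonoCopy F c true G ∧ ¬ HasMonoCopy F c false H

/-- `F` is `(G,H)`-minimal: `F → (G,H)` but no proper subgraph of `F` arrows `(G,H)`. -/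
def IsRamseyMinimal {α β γ : Type*} (F : SimpleGraph α) (G : SimpleGraph β)
    (H : SimpleGraph γ) : Prop :=
  Arrows F G H ∧ ∀ F' : F.Subgraph, F' ≠ ⊤ → ¬ Arrows F'.coe G H

/-- `G` embeds into `H` (as a, not necessarily induced, subgraph). -/
def Embeds {α β : Type*} (G : SimpleGraph α) (H : SimpleGraph β) : Prop :=
  ∃ f : α → β, Function.Injective f ∧ ∀ ⦃x y⦄, G.Adj x y → H.Adj (f x) (f y)

/-- `G` is self-embeddable: it is isomorphic to a proper subgraph of itself. -/
def SelfEmbeddable {α : Type*} (G : SimpleGraph α) : Prop :=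
  ∃ G' : G.Subgraph, G' ≠ ⊤ ∧ Nonempty (G ≃g G'.coe)

/-- A graph is leafless if no vertex has exactly one neighbor. -/
def Leafless {α : Type*} (G : SimpleGraph α) : Prop :=
  ∀ v : α, ¬ ∃! w, G.Adj v w

/-- `G` is a star `K_{1,κ}` (κ ≥ 1): a center adjacent to every other vertex,
every edge meets the center, and there is at least one other vertex. -/
def IsStar {α : Type*} (G : SimpleGraph α) : Prop :=
  ∃ c : α, (∃ v, v ≠ c) ∧ (∀ v, v ≠ c → G.Adj c v) ∧ ∀ ⦃x y⦄, G.Adj x y → x = c ∨ y = c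

/-- A star forest: every connected component is a star. -/
def IsStarForest {α : Type*} (G : SimpleGraph α) : Prop :=
  ∀ C : G.ConnectedComponent, IsStar (G.induce C.supp)

/-- The star `S_n` with `n` edges: center `none`, leaves `some i`. -/
def starGraph (n : ℕ) : SimpleGraph (Option (Fin n)) :=
  SimpleGraph.fromRel fun a b => a = none ∨ b = none

/-- Disjoint union of two graphs. -/
def sumGraph {α β : Type*} (G : SimpleGraph α) (H : SimpleGraph β) : SimpleGraph (α ⊕ β) :=
  SimpleGraph.fromRel fun a b =>
    match a, b with
    | Sum.inl a, Sum.inl b => G.Adj a b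
    | Sum.inr a, Sum.inr b => H.Adj a b
    | _, _ => False

/-- Disjoint union of a family of graphs. -/
def sigmaGraph {ι : Type*} {V : ι → Type*} (G : ∀ i, SimpleGraph (V i)) :
    SimpleGraph (Σ i, V i) :=
  SimpleGraph.fromRel fun a b => ∃ h : a.1 = b.1, (G b.1).Adj (h ▸ a.2) b.2

/-- The double ray (two-way infinite path). -/
def doubleRay : SimpleGraph ℤ := SimpleGraph.fromRel fun a b => b = a + 1

/-- The ray (one-way infinite path). -/
def rayGraph : SimpleGraph ℕ := SimpleGraph.fromRel fun a b => b = a + 1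

/-- `2S_1`: a matching with two edges. -/
def twoS1 : SimpleGraph (Fin 2 ⊕ Fin 2) :=
  sumGraph (⊤ : SimpleGraph (Fin 2)) (⊤ : SimpleGraph (Fin 2))

/-- `kℤ`: the disjoint union of `k` double rays. -/
def nZ (k : ℕ) : SimpleGraph (Σ _ : Fin k, ℤ) :=
  sigmaGraph fun _ : Fin k => doubleRay

/-- The 4-cycle. -/
def cycle4 : SimpleGraph (ZMod 4) := SimpleGraph.fromRel fun a b => b = a + 1

/-- The subdivision graph `S(G)`: each edge of `G` gets a new subdividing vertex. -/
def subdivision {α : Type*} (G : SimpleGraph α) : SimpleGraph (α ⊕ G.edgeSet) :=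
  SimpleGraph.fromRel fun a b =>
    match a, b with
    | Sum.inl v, Sum.inr e => v ∈ (e : Sym2 α)
    | _, _ => False

/-- The graph `Γ(K,A,n)`: to each `u ∈ A` of (finite) degree `m` we add `m·(n-1)` new
clones of `u`, each joined to precisely the neighbors of `u` in `K`. -/
def Gamma {α : Type*} (K : SimpleGraph α) (A : Set α) (n : ℕ) :
    SimpleGraph (α ⊕ Σ u : A, Fin ((K.neighborSet (u : α)).ncard * (n - 1))) :=
  SimpleGraph.fromRel fun a b =>
    match a, b with
    | Sum.inl x, Sum.inl y => K.Adj x y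
    | Sum.inl x, Sum.inr p => K.Adj (p.1 : α) x
    | _, _ => False

/-- The extension property of the Rado graph. -/
def ExtensionProperty {α : Type*} (R : SimpleGraph α) : Prop :=
  ∀ U W : Finset α, Disjoint U W →
    ∃ v, v ∉ U ∧ v ∉ W ∧ (∀ u ∈ U, R.Adj v u) ∧ ∀ w ∈ W, ¬ R.Adj v w

/-- The set of subdividing vertices of `S(G)`. -/
def subdividers {α : Type*} (G : SimpleGraph α) : Set (α ⊕ G.edgeSet) :=
  Set.range Sum.inr

/-- Vertex type of `Γ(S(G), A, m)` with `A` the subdividing vertices. -/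
abbrev GammaVert {α : Type*} (G : SimpleGraph α) (m : ℕ) :=
  (α ⊕ G.edgeSet) ⊕
    Σ u : subdividers G, Fin (((subdivision G).neighborSet (u : α ⊕ G.edgeSet)).ncard * (m - 1))

/-- `Γ = ⋃_{i} Γ(S(G), A, n i)` with `A` the subdividing vertices of `S(G)`. -/
def bigGamma {α : Type*} (G : SimpleGraph α) {k : ℕ} (n : Fin k → ℕ) :
    SimpleGraph (Σ i : Fin k, GammaVert G (n i)) :=
  sigmaGraph fun i => Gamma (subdivision G) (subdividers G) (n i)

/-- The set `A_{u,i}` inside `Γ`: the copy of `u` in `Γ_i` together with all its clones. -/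
def cloneSet {α : Type*} (G : SimpleGraph α) {k : ℕ} (n : Fin k → ℕ)
    (u : subdividers G) (i : Fin k) : Set (Σ i : Fin k, GammaVert G (n i)) :=
  {p | p = ⟨i, Sum.inl (u : α ⊕ G.edgeSet)⟩ ∨
    ∃ j : Fin (((subdivision G).neighborSet (u : α ⊕ G.edgeSet)).ncard * (n i - 1)),
      p = ⟨i, Sum.inr ⟨u, j⟩⟩}

theorem doubleRay_adj {a b : ℤ} : doubleRay.Adj a b ↔ b = a + 1 ∨ a = b + 1 := by
  simp only [doubleRay, SimpleGraph.fromRel_adj]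
  omega

theorem rayGraph_adj {a b : ℕ} : rayGraph.Adj a b ↔ b = a + 1 ∨ a = b + 1 := by
  simp only [rayGraph, SimpleGraph.fromRel_adj]
  omega

/-- An injective sequence of vertices whose consecutive edges all have color `col` is a
monochromatic ray. -/
theorem hasMonoCopy_rayGraph {α : Type*} {F : SimpleGraph α} {c : Sym2 α → Bool} {col : Bool}
    (f : ℕ → α) (hf : Function.Injective f)
    (h : ∀ n, F.Adj (f n) (f (n + 1)) ∧ c s(f n, f (n + 1)) = col) :
    HasMonoCopy F c col rayGraph := by
  refine ⟨f, hf, fun x y hxy => ?_⟩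
  rcases rayGraph_adj.mp hxy with rfl | rfl
  · exact h x
  · exact ⟨(h y).1.symm, Sym2.eq_swap ▸ (h y).2⟩

/-- Two vertex-disjoint edges of color `col` form a monochromatic `2S₁`. -/
theorem hasMonoCopy_twoS1 {α : Type*} {F : SimpleGraph α} {c : Sym2 α → Bool} {col : Bool}
    {p q r s : α} (hpq : F.Adj p q) (hrs : F.Adj r s) (hpr : p ≠ r) (hps : p ≠ s)
    (hqr : q ≠ r) (hqs : q ≠ s) (cpq : c s(p, q) = col) (crs : c s(r, s) = col) :
    HasMonoCopy F c col twoS1 := by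
  have cqp : c s(q, p) = col := Sym2.eq_swap ▸ cpq
  have csr : c s(s, r) = col := Sym2.eq_swap ▸ crs
  refine ⟨Sum.elim ![p, q] ![r, s], ?_, ?_⟩
  · refine Function.Injective.sumElim ?_ ?_ ?_
    · intro i j
      fin_cases i <;> fin_cases j <;> simp [hpq.ne, hpq.ne']
    · intro i j
      fin_cases i <;> fin_cases j <;> simp [hrs.ne, hrs.ne']
    · intro i j
      fin_cases i <;> fin_cases j <;> simp [*]
  · rintro (i | i) (j | j) hij <;> simp only [twoS1, sumGraph, SimpleGraph.fromRel_adj] at hij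
    · fin_cases i <;> fin_cases j <;> simp_all [hpq.symm]
    · simp at hij
    · simp at hij
    · fin_cases i <;> fin_cases j <;> simp_all [hrs.symm]

/-- `ℤ → (2S₁, ℕ)`: every red-blue coloring of the double ray yields two disjoint red edges
or a blue ray. -/
theorem stmt_11 : Arrows doubleRay twoS1 rayGraph := by
  intro c
  by_cases hpos : ∀ n : ℕ, c s((n : ℤ), ((n + 1 : ℕ) : ℤ)) = false
  · exact .inr <| hasMonoCopy_rayGraph (fun n => (n : ℤ)) (fun _ _ h => by simpa using h)
      fun n => ⟨doubleRay_adj.mpr (by omega), hpos n⟩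
  by_cases hneg : ∀ n : ℕ, c s(-1 - (n : ℤ), -1 - ((n + 1 : ℕ) : ℤ)) = false
  · exact .inr <| hasMonoCopy_rayGraph (fun n => -1 - (n : ℤ)) (fun _ _ h => by simpa using h)
      fun n => ⟨doubleRay_adj.mpr (by omega), hneg n⟩
  simp only [not_forall, Bool.not_eq_false] at hpos hneg
  obtain ⟨a, ha⟩ := hpos
  obtain ⟨b, hb⟩ := hneg
  exact .inl <| hasMonoCopy_twoS1 (doubleRay_adj.mpr (by omega)) (doubleRay_adj.mpr (by omega))
    (by omega) (by omega) (by omega) (by omega) ha hb
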